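/- Let G be a countable monoid, R a ring, and A an Artinian R-module. Let Σ ⊆ A^G be a subshift that is closed in the prodiscrete topology and is an R-submodule of A^G. Let τ_1, …, τ_r : Σ → Σ be pairwise commuting maps, each of which is the restriction to Σ of a cellular automaton A^G → A^G that maps Σ into Σ and admits a memory set with R-linear local defining map. For α = (a_1, …, a_r) ∈ ℕ^r write τ_α := τ_1^{a_1} ∘ ⋯ ∘ τ_r^{a_r}. Let E ⊆ G be a finite subset, define Ψ_E : Σ → (Σ_E)^{ℕ^r} by Ψ_E(x)(α) := (τ_α(x))|_E, and let Λ := Ψ_E(Σ). Then Λ is a subshift of finite type of (Σ_E)^{ℕ^r}: there exist a finite subset F ⊆ ℕ^r and a subset Q ⊆ (Σ_E)^F such that Λ = {y ∈ (Σ_E)^{ℕ^r} : (β ⋆ y)|_F ∈ Q for all β ∈ ℕ^r}. -/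

import Mathlib

/-- The right shift action: `(g ⋆ x)(h) = x (h * g)`. -/
def shiftMul {G A : Type*} [Mul G] (g : G) (x : G → A) : G → A := fun h => x (h * g)

/-- `τ_α = τ 0 ^[α 0] ∘ τ 1 ^[α 1] ∘ ⋯ ∘ τ (r-1) ^[α (r-1)]` as a self-map of `X`. -/
def tauPow {X : Type*} {r : ℕ} (τ : Fin r → X → X) (α : Fin r → ℕ) : X → X :=
  ((List.ofFn fun i => (τ i)^[α i] : List (Function.End X)).prod : Function.End X)

/-- A set of functions is finitely determined if it contains every function that it approximates
on each finite set; this is closedness in the prodiscrete topology. -/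
def FinitelyDetermined {N B : Type*} (S : Set (N → B)) : Prop :=
  ∀ y : N → B, (∀ F : Finset N, ∃ z ∈ S, ∀ i ∈ F, z i = y i) → y ∈ S

theorem IsClosed.finitelyDetermined {N B : Type*} [TopologicalSpace B] {S : Set (N → B)}
    (hS : IsClosed S) : FinitelyDetermined S := by
  intro y hy
  rw [← hS.closure_eq, mem_closure_iff]
  intro o ho hyo
  obtain ⟨I, u, hu, hIo⟩ := isOpen_pi_iff.1 ho y hyo
  obtain ⟨z, hz, hzy⟩ := hy I
  refine ⟨z, hIo fun i hi => ?_, hz⟩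
  rw [hzy i hi]
  exact (hu i hi).2

section LinearCompactness

variable {R V A : Type*} [Ring R] [AddCommGroup V] [Module R V] [AddCommGroup A] [Module R A]
  [IsArtinian R A]

/-- The images of a decreasing sequence of nonempty cosets in an Artinian module have a common
point. -/
theorem exists_common_value_of_antitone_cosets (X : ℕ → Set V) (W : ℕ → Submodule R V)
    (hX : Antitone X) (hW : Antitone W) (hsub : ∀ n, ∀ x ∈ X n, ∀ x' ∈ X n, x - x' ∈ W n)
    (hadd : ∀ n, ∀ x ∈ X n, ∀ w ∈ W n, x + w ∈ X n) (hne : ∀ n, (X n).Nonempty)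
    (φ : V →ₗ[R] A) : ∃ b, ∀ n, ∃ x ∈ X n, φ x = b := by
  obtain ⟨N, hN⟩ := IsArtinian.monotone_stabilizes (R := R) (M := A)
    ⟨fun n => OrderDual.toDual ((W n).map φ), fun m n h => Submodule.map_mono (hW h)⟩
  obtain ⟨x, hx⟩ := hne N
  refine ⟨φ x, fun n => ?_⟩
  rcases le_total n N with h | h
  · exact ⟨x, hX h hx, rfl⟩
  · obtain ⟨x', hx'⟩ := hne n
    have h1 : φ (x - x') ∈ (W N).map φ := Submodule.mem_map_of_mem (hsub N x hx x' (hX h hx'))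
    have h2 : (W N).map φ = (W n).map φ := hN n h
    rw [h2] at h1
    obtain ⟨w, hw, hwx⟩ := h1
    refine ⟨x' + w, hadd n x' hx' w hw, ?_⟩
    rw [map_add, hwx, map_sub]
    abel

/-- Given a decreasing sequence of nonempty cosets and countably many coordinates with values in
an Artinian module, there are coordinate values which can be realised finitely many at a time in
each of the cosets. -/
theorem exists_values_of_antitone_cosets (X : ℕ → Set V) (W : ℕ → Submodule R V)
    (hX : Antitone X) (hW : Antitone W) (hsub : ∀ n, ∀ x ∈ X n, ∀ x' ∈ X n, x - x' ∈ W n)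
    (hadd : ∀ n, ∀ x ∈ X n, ∀ w ∈ W n, x + w ∈ X n) (hne : ∀ n, (X n).Nonempty)
    (φ : ℕ → V →ₗ[R] A) : ∃ a : ℕ → A, ∀ n k, ∃ x ∈ X n, ∀ j < k, φ j x = a j := by
  let Good : ℕ → (ℕ → A) → Prop := fun k a => ∀ n, ∃ x ∈ X n, ∀ j < k, φ j x = a j
  have step : ∀ k (p : {a // Good k a}), ∃ b, Good (k + 1) (Function.update p.1 k b) := by
    rintro k ⟨a, ha⟩
    obtain ⟨b, hb⟩ := exists_common_value_of_antitone_cosets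
      (fun n => {x | x ∈ X n ∧ ∀ j < k, φ j x = a j})
      (fun n => W n ⊓ ⨅ j, ⨅ (_ : j < k), LinearMap.ker (φ j))
      (fun m n h x hx => ⟨hX h hx.1, hx.2⟩) (fun m n h => inf_le_inf_right _ (hW h))
      (fun n x hx x' hx' => by
        refine ⟨hsub n x hx.1 x' hx'.1, ?_⟩
        simp only [SetLike.mem_coe, Submodule.mem_iInf, LinearMap.mem_ker]
        intro j hj
        rw [map_sub, hx.2 j hj, hx'.2 j hj, sub_self])
      (fun n x hx w hw => by
        refine ⟨hadd n x hx.1 w hw.1, fun j hj => ?_⟩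
        have h2 := hw.2
        simp only [SetLike.mem_coe, Submodule.mem_iInf, LinearMap.mem_ker] at h2
        rw [map_add, hx.2 j hj, h2 j hj, add_zero])
      ha (φ k)
    refine ⟨b, fun n => ?_⟩
    obtain ⟨x, hx, hxb⟩ := hb n
    refine ⟨x, hx.1, fun j hj => ?_⟩
    rcases Nat.lt_succ_iff_lt_or_eq.1 hj with h | rfl
    · rw [Function.update_of_ne h.ne, hx.2 j h]
    · rw [Function.update_self, hxb]
  choose b hb using step
  have h0 : ∃ a, Good 0 a := ⟨0, fun n => (hne n).imp fun x hx => ⟨hx, by simp⟩⟩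
  let s : (k : ℕ) → {a // Good k a} := fun k =>
    Nat.rec ⟨h0.choose, h0.choose_spec⟩ (fun k p => ⟨Function.update p.1 k (b k p), hb k p⟩) k
  have hs : ∀ k, (s (k + 1)).1 = Function.update (s k).1 k (b k (s k)) := fun k => rfl
  have hstab : ∀ j k, j + 1 ≤ k → (s k).1 j = (s (j + 1)).1 j := by
    intro j k hk
    induction k, hk using Nat.le_induction with
    | base => rfl
    | succ k hk ih => rw [hs k, Function.update_of_ne (by omega), ih]
  refine ⟨fun j => (s (j + 1)).1 j, fun n k => ?_⟩
  obtain ⟨x, hx, hxk⟩ := (s k).2 n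
  exact ⟨x, hx, fun j hj => (hxk j hj).trans (hstab j k hj)⟩

/-- The image of a closed submodule under a linear map each of whose coordinates depends on
finitely many coordinates is closed. -/
theorem finitelyDetermined_range_of_local {G N B : Type*} [Nonempty G] [Countable G]
    [Preorder N] [LocallyFiniteOrderBot N] [AddCommGroup B] [Module R B]
    (S : Submodule R (G → A)) (hS : FinitelyDetermined (S : Set (G → A)))
    (Ψ : S →ₗ[R] (N → B))
    (hΨ : ∀ α, ∃ M : Finset G, ∀ x x' : S, (∀ g ∈ M, x.1 g = x'.1 g) → Ψ x α = Ψ x' α)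
    (c : ℕ → N) (hc : Monotone c) (hcof : ∀ α, ∃ n, α ≤ c n) :
    FinitelyDetermined (Set.range Ψ) := by
  intro y hy
  obtain ⟨e, he⟩ := exists_surjective_nat G
  obtain ⟨a, ha⟩ := exists_values_of_antitone_cosets
    (fun n => {x : S | ∀ α ≤ c n, Ψ x α = y α})
    (fun n => (Submodule.pi {α | α ≤ c n} fun _ => (⊥ : Submodule R B)).comap Ψ)
    (fun m n h x hx α hα => hx α (le_trans hα (hc h)))
    (fun m n h x hx α hα => hx α (le_trans hα (hc h)))
    (fun n x hx x' hx' α hα => by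
      rw [map_sub, Pi.sub_apply, hx α hα, hx' α hα, sub_self]
      exact Submodule.zero_mem _)
    (fun n x hx w hw α hα => by
      rw [map_add, Pi.add_apply, hx α hα, (Submodule.mem_bot R).1 (hw α hα), add_zero])
    (fun n => by
      obtain ⟨_, ⟨x, rfl⟩, hx⟩ := hy (Finset.Iic (c n))
      exact ⟨x, fun α hα => hx α (Finset.mem_Iic.2 hα)⟩)
    (fun j => LinearMap.proj (R := R) (φ := fun _ : G => A) (e j) ∘ₗ S.subtype)
  choose i hi using he
  have happ : ∀ n (F : Finset G), ∃ x : S, (∀ α ≤ c n, Ψ x α = y α) ∧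
      ∀ g ∈ F, x.1 g = a (i g) := by
    intro n F
    obtain ⟨x, hx, hxa⟩ := ha n (F.sup i + 1)
    refine ⟨x, hx, fun g hg => ?_⟩
    have := hxa (i g) (Nat.lt_succ_of_le (Finset.le_sup hg))
    simpa [hi g] using this
  have hmem : (fun g => a (i g)) ∈ S := hS _ fun F => by
    obtain ⟨x, -, hx⟩ := happ 0 F
    exact ⟨x.1, x.2, hx⟩
  refine ⟨⟨_, hmem⟩, funext fun α => ?_⟩
  obtain ⟨M, hM⟩ := hΨ α
  obtain ⟨n, hn⟩ := hcof α
  obtain ⟨x, hx, hxM⟩ := happ n M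
  rw [← hx α hn]
  exact hM _ _ fun g hg => (hxM g hg).symm

end LinearCompactness

/-- An injective enumeration of `ℕ^r` compatible with addition (the graded lexicographic
order). -/
theorem exists_injective_translation_monotone (r : ℕ) :
    ∃ k : (Fin r → ℕ) → ℕ, Function.Injective k ∧
      ∀ α β γ, k α < k β → k (α + γ) < k (β + γ) := by
  let key : (Fin r → ℕ) → ℕ ×ₗ Lex (Fin r → ℕ) := fun α => toLex (∑ i, α i, toLex α)
  have hkey : Function.Injective key := fun α β h => by
    have h2 := congrArg (fun p => ofLex (ofLex p).2) h
    exact h2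
  have hadd : ∀ α β, key (α + β) = key α + key β := fun α β => by
    simp only [key, Pi.add_apply, Finset.sum_add_distrib]
    rfl
  have hfin : ∀ α, {γ | key γ < key α}.Finite := fun α => by
    refine (Set.finite_Iic (fun _ => ∑ i, α i : Fin r → ℕ)).subset fun γ hγ i => ?_
    have h1 : ∑ i, γ i ≤ ∑ i, α i := by
      rcases Prod.Lex.toLex_lt_toLex.1 hγ with h | h
      · exact h.le
      · exact h.1.le
    exact (Finset.single_le_sum (f := γ) (fun _ _ => Nat.zero_le _) (Finset.mem_univ i)).trans h1
  have hlt : ∀ α β, key α < key β → {γ | key γ < key α}.ncard < {γ | key γ < key β}.ncard :=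
    fun α β h => Set.ncard_lt_ncard
      ⟨fun γ hγ => lt_trans hγ h, fun hs => lt_irrefl (key α) (hs h)⟩ (hfin β)
  refine ⟨fun α => {γ | key γ < key α}.ncard, fun α β h => ?_, fun α β γ h => ?_⟩
  · rcases lt_trichotomy (key α) (key β) with h' | h' | h'
    · exact absurd h (hlt _ _ h').ne
    · exact hkey h'
    · exact absurd h (hlt _ _ h').ne'
  · apply hlt
    rw [hadd, hadd]
    refine add_lt_add_left ?_ _
    rcases lt_trichotomy (key α) (key β) with h' | h' | h'
    · exact h'
    · exact absurd h (by simp [h'])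
    · exact absurd h (hlt _ _ h').not_gt

section SubmodulesOfFullShift

variable {R B : Type*} [Ring R] [AddCommGroup B] [Module R B]

/-- The leading coefficients at `α` of the elements of `Λ` which vanish at all positions
preceding `α` in the enumeration `k`. -/
def leadingCoeffs {N : Type*} (k : N → ℕ) (Λ : Submodule R (N → B)) (α : N) : Submodule R B :=
  (Λ ⊓ ⨅ γ, ⨅ (_ : k γ < k α), LinearMap.ker (LinearMap.proj γ)).map (LinearMap.proj α)

theorem mem_leadingCoeffs {N : Type*} {k : N → ℕ} {Λ : Submodule R (N → B)} {α : N} {b : B} :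
    b ∈ leadingCoeffs k Λ α ↔ ∃ y ∈ Λ, (∀ γ, k γ < k α → y γ = 0) ∧ y α = b := by
  simp [leadingCoeffs, Submodule.mem_iInf, and_assoc]

theorem leadingCoeffs_mono {N : Type*} {k : N → ℕ} {Λ Λ' : Submodule R (N → B)} (h : Λ ≤ Λ')
    (α : N) : leadingCoeffs k Λ α ≤ leadingCoeffs k Λ' α :=
  Submodule.map_mono (inf_le_inf_right _ h)

theorem eq_of_leadingCoeffs_le {N : Type*} {k : N → ℕ} (hk : Function.Injective k)
    {Λ Λ' : Submodule R (N → B)} (hfd : FinitelyDetermined (Λ : Set (N → B))) (h : Λ ≤ Λ')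
    (hle : ∀ α, leadingCoeffs k Λ' α ≤ leadingCoeffs k Λ α) : Λ = Λ' := by
  refine le_antisymm h fun y hy => ?_
  have happ : ∀ n, ∃ z ∈ Λ, ∀ γ, k γ < n → z γ = y γ := by
    intro n
    induction n with
    | zero => exact ⟨0, Λ.zero_mem, by simp⟩
    | succ n ih =>
      obtain ⟨z, hz, hzy⟩ := ih
      by_cases hn : ∃ α, k α = n
      · obtain ⟨α, rfl⟩ := hn
        obtain ⟨w, hw, hw0, hwα⟩ := mem_leadingCoeffs.1 (hle α (mem_leadingCoeffs.2
          ⟨y - z, Λ'.sub_mem hy (h hz), fun γ hγ => by simp [hzy γ hγ], rfl⟩))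
        refine ⟨z + w, Λ.add_mem hz hw, fun γ hγ => ?_⟩
        rcases Nat.lt_succ_iff_lt_or_eq.1 hγ with h' | h'
        · simp [hzy γ h', hw0 γ h']
        · rw [hk h']
          simp [hwα]
      · refine ⟨z, hz, fun γ hγ => hzy γ ?_⟩
        rcases Nat.lt_succ_iff_lt_or_eq.1 hγ with h' | h'
        · exact h'
        · exact absurd ⟨γ, h'⟩ hn
  refine hfd y fun F => ?_
  obtain ⟨z, hz, hzy⟩ := happ (F.sup k + 1)
  exact ⟨z, hz, fun γ hγ => hzy γ (Nat.lt_succ_of_le (Finset.le_sup hγ))⟩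

variable {r : ℕ}

/-- A submodule of `B^(ℕ^r)` which is invariant under shifts and closed. -/
def IsClosedSubshift (Λ : Submodule R ((Fin r → ℕ) → B)) : Prop :=
  (∀ β, ∀ y ∈ Λ, (fun α => y (α + β)) ∈ Λ) ∧ FinitelyDetermined (Λ : Set ((Fin r → ℕ) → B))

theorem leadingCoeffs_antitone {k : (Fin r → ℕ) → ℕ}
    (hk : ∀ α β γ, k α < k β → k (α + γ) < k (β + γ)) {Λ : Submodule R ((Fin r → ℕ) → B)}
    (hΛ : ∀ β, ∀ y ∈ Λ, (fun α => y (α + β)) ∈ Λ) : Antitone (leadingCoeffs k Λ) := by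
  intro α β hαβ b hb
  obtain ⟨δ, rfl⟩ := exists_add_of_le hαβ
  obtain ⟨y, hy, hy0, rfl⟩ := mem_leadingCoeffs.1 hb
  exact mem_leadingCoeffs.2 ⟨_, hΛ δ y hy, fun γ hγ => hy0 _ (hk _ _ _ hγ), rfl⟩

theorem wellFounded_closedSubshifts [IsArtinian R B] :
    WellFounded fun Λ Λ' : {Λ : Submodule R ((Fin r → ℕ) → B) // IsClosedSubshift Λ} =>
      Λ < Λ' := by
  obtain ⟨k, hinj, hk⟩ := exists_injective_translation_monotone r
  rw [RelEmbedding.wellFounded_iff_isEmpty]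
  refine ⟨fun f => ?_⟩
  have hf : ∀ m n, m < n → (f n).1 < (f m).1 := fun m n h => f.map_rel_iff.2 h
  have hdrop : ∀ n, ∃ α, ¬ leadingCoeffs k (f n).1 α ≤ leadingCoeffs k (f (n + 1)).1 α := by
    intro n
    by_contra! hcon
    exact (hf n (n + 1) n.lt_succ_self).ne
      (eq_of_leadingCoeffs_le hinj (f (n + 1)).2.2 (hf n _ n.lt_succ_self).le hcon)
  choose α hα using hdrop
  obtain ⟨g, hg⟩ := WellQuasiOrdered.exists_monotone_subseq
    (r := fun a b : Fin r → ℕ => a ≤ b) wellQuasiOrdered_le α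
  have hanti : ∀ n, leadingCoeffs k (f (g (n + 1))).1 (α (g (n + 1))) <
      leadingCoeffs k (f (g n)).1 (α (g n)) := by
    intro n
    have hgn : g n < g (n + 1) := g.strictMono n.lt_succ_self
    have h1 : leadingCoeffs k (f (g (n + 1))).1 (α (g (n + 1))) ≤
        leadingCoeffs k (f (g n + 1)).1 (α (g n)) := by
      refine (leadingCoeffs_antitone hk (f (g (n + 1))).2.1 (hg _ _ n.le_succ)).trans
        (leadingCoeffs_mono ?_ _)
      rcases (Nat.succ_le_of_lt hgn).eq_or_lt with h | h
      · rw [← h]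
      · exact (hf _ _ h).le
    have h2 := leadingCoeffs_mono (k := k) (hf _ _ (g n).lt_succ_self).le (α (g n))
    exact lt_of_le_of_ne (h1.trans h2) fun h => hα (g n) (h ▸ h1)
  exact (wellFounded_iff_isEmpty_descending_chain.1
    (wellFounded_lt (α := Submodule R B))).false
    ⟨fun n => leadingCoeffs k (f (g n)).1 (α (g n)), hanti⟩

/-- The closed subshift defined by the restrictions of `Λ` to `F`. -/
def finiteTypeHull (F : Finset (Fin r → ℕ)) (Λ : Submodule R ((Fin r → ℕ) → B)) :
    Submodule R ((Fin r → ℕ) → B) where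
  carrier := {y | ∀ β, ∃ z ∈ Λ, ∀ f ∈ F, z f = y (f + β)}
  add_mem' := fun {y y'} hy hy' β => by
    obtain ⟨z, hz, h⟩ := hy β
    obtain ⟨z', hz', h'⟩ := hy' β
    exact ⟨z + z', Λ.add_mem hz hz', fun f hf => by simp [h f hf, h' f hf]⟩
  zero_mem' := fun β => ⟨0, Λ.zero_mem, fun f _ => rfl⟩
  smul_mem' := fun c y hy β => by
    obtain ⟨z, hz, h⟩ := hy β
    exact ⟨c • z, Λ.smul_mem c hz, fun f hf => by simp [h f hf]⟩

theorem isClosedSubshift_finiteTypeHull (F : Finset (Fin r → ℕ))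
    (Λ : Submodule R ((Fin r → ℕ) → B)) : IsClosedSubshift (finiteTypeHull F Λ) := by
  classical
  refine ⟨fun γ y hy β => ?_, fun y hy β => ?_⟩
  · obtain ⟨z, hz, h⟩ := hy (β + γ)
    exact ⟨z, hz, fun f hf => by simp only [h f hf, add_assoc]⟩
  · obtain ⟨w, hw, hwy⟩ := hy (F.image (· + β))
    obtain ⟨z, hz, h⟩ := hw β
    exact ⟨z, hz, fun f hf => (h f hf).trans (hwy _ (Finset.mem_image_of_mem _ hf))⟩

/-- Closed subshifts of `B^(ℕ^r)` which are submodules are of finite type if `B` is Artinian. -/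
theorem IsClosedSubshift.exists_finiteTypeHull_eq [IsArtinian R B]
    {Λ : Submodule R ((Fin r → ℕ) → B)} (hΛ : IsClosedSubshift Λ) : ∃ F, finiteTypeHull F Λ = Λ := by
  classical
  obtain ⟨⟨_, _⟩, ⟨F, hF⟩, hmin⟩ := wellFounded_closedSubshifts.has_min
    (Set.range fun F => (⟨finiteTypeHull F Λ, isClosedSubshift_finiteTypeHull F Λ⟩ :
      {Λ : Submodule R ((Fin r → ℕ) → B) // IsClosedSubshift Λ})) ⟨_, ∅, rfl⟩
  rw [← hF] at hmin
  have hmono : ∀ F F' : Finset (Fin r → ℕ), F ⊆ F' → finiteTypeHull F' Λ ≤ finiteTypeHull F Λ :=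
    fun F F' h y hy β => by
      obtain ⟨z, hz, hzy⟩ := hy β
      exact ⟨z, hz, fun f hf => hzy f (h hf)⟩
  refine ⟨F, le_antisymm (fun y hy => hΛ.2 y fun F' => ?_) fun y hy β => ⟨_, hΛ.1 β y hy, by simp⟩⟩
  have heq : finiteTypeHull (F ∪ F') Λ = finiteTypeHull F Λ := by
    by_contra hne
    exact hmin _ ⟨F ∪ F', rfl⟩ (lt_of_le_of_ne (hmono _ _ Finset.subset_union_left)
      fun h => hne (congrArg Subtype.val h))
  rw [← heq] at hy
  obtain ⟨z, hz, hzy⟩ := hy 0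
  exact ⟨z, hz, fun f hf => by simpa using hzy f (Finset.mem_union_right _ hf)⟩

end SubmodulesOfFullShift

theorem List.prod_ofFn_mul_of_commute {M : Type*} [Monoid M] {r : ℕ} (f g : Fin r → M)
    (h : ∀ i j, Commute (g i) (f j)) :
    (List.ofFn fun i => f i * g i).prod = (List.ofFn f).prod * (List.ofFn g).prod := by
  induction r with
  | zero => simp
  | succ r ih =>
    simp only [List.ofFn_succ, List.prod_cons]
    rw [ih _ _ fun i j => h i.succ j.succ]
    have hc : Commute (g 0) (List.ofFn fun i : Fin r => f i.succ).prod :=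
      Commute.list_prod_right _ _ fun x hx => by
        obtain ⟨i, rfl⟩ := List.mem_ofFn.1 hx
        exact h 0 i.succ
    simp only [mul_assoc]
    rw [← mul_assoc (g 0), hc.eq, mul_assoc]

theorem tauPow_add {X : Type*} {r : ℕ} (τ : Fin r → X → X)
    (hcomm : ∀ i j x, τ i (τ j x) = τ j (τ i x)) (α β : Fin r → ℕ) (x : X) :
    tauPow τ (α + β) x = tauPow τ α (tauPow τ β x) := by
  let T : Fin r → Function.End X := τ
  have hiter : ∀ γ : Fin r → ℕ, tauPow τ γ = (List.ofFn fun i => T i ^ γ i).prod := fun γ => by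
    have h : ∀ (i : Fin r) (n : ℕ), (τ i)^[n] = T i ^ n := fun i n => by
      induction n with
      | zero => rfl
      | succ n ih =>
        rw [pow_succ, ← ih]
        rfl
    simp only [tauPow, h]
    rfl
  have hc : ∀ i j, Commute (T i) (T j) := fun i j => funext fun x => hcomm i j x
  have h := List.prod_ofFn_mul_of_commute (fun i => T i ^ α i) (fun i => T i ^ β i)
    fun i j => (hc i j).pow_pow _ _
  simp only [← pow_add] at h
  rw [hiter α, hiter β, hiter (α + β)]
  exact congrFun h x

section LocalLinearMaps

variable {G R A : Type*} [Ring R] [AddCommGroup A] [Module R A]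

/-- Linear self-maps of a module of configurations, each value of which depends on finitely many
coordinates. -/
def localLinearEnd (S : Submodule R (G → A)) : Submonoid (Function.End S) where
  carrier := {f | IsLinearMap R f ∧
    ∀ g, ∃ M : Finset G, ∀ x x' : S, (∀ m ∈ M, x.1 m = x'.1 m) → (f x).1 g = (f x').1 g}
  one_mem' := ⟨⟨fun _ _ => rfl, fun _ _ => rfl⟩, fun g => ⟨{g}, fun x x' h => h g (by simp)⟩⟩
  mul_mem' := by
    classical
    rintro f f' ⟨hf, hloc⟩ ⟨hf', hloc'⟩
    refine ⟨⟨fun x y => ?_, fun c x => ?_⟩, fun g => ?_⟩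
    · change f (f' (x + y)) = f (f' x) + f (f' y)
      rw [hf'.map_add, hf.map_add]
    · change f (f' (c • x)) = c • f (f' x)
      rw [hf'.map_smul, hf.map_smul]
    · obtain ⟨M, hM⟩ := hloc g
      choose M' hM' using hloc'
      refine ⟨M.biUnion M', fun x x' h => hM _ _ fun m hm => hM' m _ _ fun m' hm' => ?_⟩
      exact h m' (Finset.mem_biUnion.2 ⟨m, hm, hm'⟩)

theorem tauPow_mem_localLinearEnd {S : Submodule R (G → A)} {r : ℕ} {τ : Fin r → S → S}
    (hτ : ∀ i, τ i ∈ localLinearEnd S) (α : Fin r → ℕ) : tauPow τ α ∈ localLinearEnd S := by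
  refine (localLinearEnd S).list_prod_mem fun f hf => ?_
  obtain ⟨i, rfl⟩ := List.mem_ofFn.1 hf
  have h : ∀ n, (τ i)^[n] ∈ localLinearEnd S := fun n => by
    induction n with
    | zero => exact (localLinearEnd S).one_mem
    | succ n ih => exact (localLinearEnd S).mul_mem ih (hτ i)
  exact h (α i)

theorem mem_localLinearEnd_of_localMap [Monoid G] {S : Submodule R (G → A)} {f : S → S}
    (hf : ∃ (M : Finset G) (μ : (↥(M : Set G) → A) →ₗ[R] A),
      ∀ (x : S) (g : G), (f x).1 g = μ fun m : ↥(M : Set G) => x.1 (↑m * g)) :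
    f ∈ localLinearEnd S := by
  classical
  obtain ⟨M, μ, h⟩ := hf
  refine ⟨⟨fun x y => ?_, fun c x => ?_⟩, fun g => ⟨M.image (· * g), fun x x' hx => ?_⟩⟩
  · refine Subtype.ext (funext fun g => ?_)
    rw [Submodule.coe_add, Pi.add_apply, h, h, h, ← map_add]
    rfl
  · refine Subtype.ext (funext fun g => ?_)
    rw [Submodule.coe_smul, Pi.smul_apply, h, h, ← map_smul]
    rfl
  · rw [h, h]
    congr 1
    funext m
    exact hx _ (Finset.mem_image_of_mem _ m.2)

end LocalLinearMaps

theorem statement15 {G : Type*} [Monoid G] [Countable G]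
    {R : Type*} [Ring R] {A : Type*} [AddCommGroup A] [Module R A] [IsArtinian R A]
    [TopologicalSpace A] [DiscreteTopology A]
    (Sgm : Submodule R (G → A))
    (hshift : ∀ g : G, ∀ x ∈ Sgm, shiftMul g x ∈ Sgm)
    (hclosed : IsClosed (Sgm : Set (G → A)))
    {r : ℕ} (τ : Fin r → ↥Sgm → ↥Sgm)
    (hcomm : ∀ i j x, τ i (τ j x) = τ j (τ i x))
    (hloc : ∀ i, ∃ (M : Finset G) (μ : (↥(M : Set G) → A) →ₗ[R] A),
      ∀ (x : ↥Sgm) (g : G), (τ i x).1 g = μ fun m : ↥(M : Set G) => x.1 (↑m * g))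
    (E : Finset G)
    (SE : Set (↥(E : Set G) → A))
    (hSE : SE = Set.range fun x : ↥Sgm => fun e : ↥(E : Set G) => x.1 ↑e)
    (Λ : Set ((Fin r → ℕ) → ↥(E : Set G) → A))
    (hΛ : Λ = Set.range fun x : ↥Sgm =>
      fun (α : Fin r → ℕ) (e : ↥(E : Set G)) => (tauPow τ α x).1 ↑e) :
    ∃ (F : Finset (Fin r → ℕ)) (Q : Set (↥(F : Set (Fin r → ℕ)) → ↥(E : Set G) → A)),
      (∀ q ∈ Q, ∀ f : ↥(F : Set (Fin r → ℕ)), q f ∈ SE) ∧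
      Λ = {y | (∀ α : Fin r → ℕ, y α ∈ SE) ∧
        ∀ β : Fin r → ℕ, (fun f : ↥(F : Set (Fin r → ℕ)) => y (↑f + β)) ∈ Q} := by
  classical
  have hmem := tauPow_mem_localLinearEnd fun i => mem_localLinearEnd_of_localMap (hloc i)
  let Ψ : Sgm →ₗ[R] ((Fin r → ℕ) → ↥(E : Set G) → A) :=
    { toFun := fun x α e => (tauPow τ α x).1 ↑e
      map_add' := fun x y => by
        funext α e
        rw [(hmem α).1.map_add]
        rfl
      map_smul' := fun c x => by
        funext α e
        rw [(hmem α).1.map_smul]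
        rfl }
  have hfd : FinitelyDetermined (Set.range Ψ) := by
    refine finitelyDetermined_range_of_local Sgm hclosed.finitelyDetermined Ψ (fun α => ?_)
      (fun n _ => n) (fun m n h _ => h)
      fun α => ⟨Finset.univ.sup α, fun i => Finset.le_sup (Finset.mem_univ i)⟩
    choose M hM using (hmem α).2
    exact ⟨E.biUnion M, fun x x' h => funext fun e =>
      hM e x x' fun m hm => h m (Finset.mem_biUnion.2 ⟨e, e.2, hm⟩)⟩
  have hsub : IsClosedSubshift (LinearMap.range Ψ) := by
    refine ⟨?_, by rwa [LinearMap.coe_range]⟩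
    rintro β _ ⟨x, rfl⟩
    refine ⟨tauPow τ β x, funext fun α => funext fun e => ?_⟩
    exact congrArg (fun z : Sgm => z.1 ↑e) (tauPow_add τ hcomm α β x).symm
  have hSEmem : ∀ x α, Ψ x α ∈ SE := fun x α => hSE ▸ ⟨tauPow τ α x, rfl⟩
  obtain ⟨F, hF⟩ := hsub.exists_finiteTypeHull_eq
  refine ⟨F, Set.range fun (x : Sgm) (f : ↥(F : Set (Fin r → ℕ))) => Ψ x ↑f, ?_, ?_⟩
  · rintro _ ⟨x, rfl⟩ f
    exact hSEmem x f
  · rw [hΛ]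
    refine Set.ext fun y => ⟨?_, fun hy => ?_⟩
    · rintro ⟨x, rfl⟩
      refine ⟨hSEmem x, fun β => ?_⟩
      obtain ⟨x', hx'⟩ := hsub.1 β _ ⟨x, rfl⟩
      exact ⟨x', funext fun f => congrFun hx' f⟩
    · have hy' : y ∈ finiteTypeHull F (LinearMap.range Ψ) := fun β => by
        obtain ⟨x, hx⟩ := hy.2 β
        exact ⟨Ψ x, ⟨x, rfl⟩, fun f hf => congrFun hx ⟨f, hf⟩⟩
      rw [hF] at hy'
      exact hy'
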